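/- arXiv:1708.05694 — 2 statements merged into one kernel-verified Lean document; each statement's English description precedes it below -/
import Mathlib

section
/- (A solution of the tetrahedron equation.) For real parameters p₁,…,p₄, q₁,…,q₄, set ρ_a = p_a − q_a and for a triple (i,j,k) set δ_{ijk} = (p_j−q_i) ρ_i ρ_j + (q_k−q_i) ρ_i ρ_k + (q_k−p_j) ρ_j ρ_k, and let γ^{ijk} be the 3×3 matrix with entries γ₁₁ = ρ_k(ρ_i(p_k+q_k−2q_i) + ρ_j(p_k+q_k−2p_j)), γ₂₂ = ρ_j(ρ_i(p_j+q_j−2q_i) − ρ_k(p_j+q_j−2q_k)), γ₃₃ = −ρ_i(ρ_j(p_i+q_i−2p_j) + ρ_k(p_i+q_i−2q_k)), γ₁₂ = −ρ_k ((ρ_i²−ρ_j²)/(ρ_i²−ρ_k²)) (ρ_k² − ρ_i(p_k+q_k−2q_i)), γ₁₃ = −ρ_k ((ρ_i²−ρ_j²)/(ρ_j²−ρ_k²)) (ρ_j(p_k+q_k−2p_j) + ρ_k²), γ₂₁ = −ρ_j ((ρ_i²−ρ_k²)/(ρ_i²−ρ_j²)) (ρ_j² − ρ_i(p_j+q_j−2q_i)),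 γ₂₃ = ρ_j ((ρ_i²−ρ_k²)/(ρ_j²−ρ_k²)) (ρ_j² − ρ_k(p_j+q_j−2q_k)), γ₃₁ = ρ_i ((ρ_j²−ρ_k²)/(ρ_i²−ρ_j²)) (ρ_j(p_i+q_i−2p_j) + ρ_i²), γ₃₂ = ρ_i ((ρ_j²−ρ_k²)/(ρ_i²−ρ_k²)) (ρ_i² − ρ_k(p_i+q_i−2q_k)). Define S(i,j,k) = (1/δ_{ijk}) γ^{ijk} − 1₃. Assume ρ_a² ≠ ρ_b² for all a ≠ b in {1,2,3,4} and δ_{123}, δ_{124}, δ_{134}, δ_{234} ≠ 0. Let S_{αβγ}(i,j,k) denote the 6×6 matrix equal to the identity except that the 3×3 block S(i,j,k) is placed at rows and columns (α,β,γ). Then with ℛ₁₂₃ = S_{123}(1,2,3), ℛ₁₄₅ = S_{145}(1,2,4), ℛ₂₄₆ = S_{246}(1,3,4), ℛ₃₅₆ = S_{356}(2,3,4), the tetrahedron equation ℛ₁₂₃ ℛ₁₄₅ ℛ₂₄₆ ℛ₃₅₆ = ℛ₃₅₆ ℛ₂₄₆ ℛ₁₄₅ ℛ₁₂₃ holds.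 -/
open Matrix

/-- `δ_{ijk}` for the tetrahedron solution, with `ρ_a = p_a − q_a`. -/
def deltaT (p q : Fin 4 → ℝ) (i j k : Fin 4) : ℝ :=
  (p j - q i) * ((p i - q i) * (p j - q j)) + (q k - q i) * ((p i - q i) * (p k - q k))
    + (q k - p j) * ((p j - q j) * (p k - q k))

/-- The 3×3 matrix `S(i,j,k) = (1/δ_{ijk}) γ^{ijk} − 1₃`. -/
noncomputable def Smat (p q : Fin 4 → ℝ) (i j k : Fin 4) : Matrix (Fin 3) (Fin 3) ℝ :=
  let ρ : Fin 4 → ℝ := fun a => p a - q a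
  (deltaT p q i j k)⁻¹ •
    !![ρ k * (ρ i * (p k + q k - 2 * q i) + ρ j * (p k + q k - 2 * p j)),
       -(ρ k * ((ρ i ^ 2 - ρ j ^ 2) / (ρ i ^ 2 - ρ k ^ 2))
          * (ρ k ^ 2 - ρ i * (-(2 * q i) + p k + q k))),
       -(ρ k * ((ρ i ^ 2 - ρ j ^ 2) / (ρ j ^ 2 - ρ k ^ 2))
          * (ρ j * (p k + q k - 2 * p j) + ρ k ^ 2));
       -(ρ j * ((ρ i ^ 2 - ρ k ^ 2) / (ρ i ^ 2 - ρ j ^ 2))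
          * (ρ j ^ 2 - ρ i * (p j + q j - 2 * q i))),
       ρ j * (ρ i * (p j + q j - 2 * q i) - ρ k * (p j + q j - 2 * q k)),
       ρ j * ((ρ i ^ 2 - ρ k ^ 2) / (ρ j ^ 2 - ρ k ^ 2))
          * (ρ j ^ 2 - ρ k * (p j + q j - 2 * q k));
       ρ i * ((ρ j ^ 2 - ρ k ^ 2) / (ρ i ^ 2 - ρ j ^ 2))
          * (ρ j * (p i + q i - 2 * p j) + ρ i ^ 2),
       ρ i * ((ρ j ^ 2 - ρ k ^ 2) / (ρ i ^ 2 - ρ k ^ 2))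
          * (ρ i ^ 2 - ρ k * (p i + q i - 2 * q k)),
       -(ρ i * (ρ j * (p i + q i - 2 * p j) + ρ k * (p i + q i - 2 * q k)))]
    - 1

/-- Embedding of a 3×3 matrix into the 6×6 identity at the rows/columns `f 0, f 1, f 2`. -/
def embT (f : Fin 3 → Fin 6) (B : Matrix (Fin 3) (Fin 3) ℝ) : Matrix (Fin 6) (Fin 6) ℝ :=
  Matrix.of fun r s =>
    (∑ i, ∑ j, if f i = r ∧ f j = s then B i j else 0)
      + if (∀ i, f i ≠ r) ∧ r = s then 1 else 0

/-- Polynomial expressions in seven variables, used for verifying polynomial identities by evaluation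
at a single, sufficiently large integer point. -/
inductive PolyExpr where
  | zero : PolyExpr
  | one : PolyExpr
  | var : Fin 7 → PolyExpr
  | neg : PolyExpr → PolyExpr
  | add : PolyExpr → PolyExpr → PolyExpr
  | mul : PolyExpr → PolyExpr → PolyExpr

namespace PolyExpr

/-- The value of an expression in a commutative ring. -/
def eval {R : Type*} [CommRing R] (v : Fin 7 → R) : PolyExpr → R
  | zero => 0
  | one => 1
  | var i => v i
  | neg e => -eval v e
  | add e f => eval v e + eval v f
  | mul e f => eval v e * eval v f

/-- The value of an expression with all signs removed. -/
def evalAbs {R : Type*} [CommRing R] (v : Fin 7 → R) : PolyExpr → R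
  | zero => 0
  | one => 1
  | var i => v i
  | neg e => evalAbs v e
  | add e f => evalAbs v e + evalAbs v f
  | mul e f => evalAbs v e * evalAbs v f

/-- An upper bound for the sum of the absolute values of the coefficients. -/
def coeffBound : PolyExpr → ℕ
  | zero => 0
  | one => 1
  | var _ => 1
  | neg e => coeffBound e
  | add e f => coeffBound e + coeffBound f
  | mul e f => coeffBound e * coeffBound f

/-- An upper bound for the degree in the variable `i`. -/
def degBound (i : Fin 7) : PolyExpr → ℕ
  | zero => 0
  | one => 0
  | var j => if i = j then 1 else 0
  | neg e => degBound i e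
  | add e f => max (degBound i e) (degBound i f)
  | mul e f => degBound i e + degBound i f

/-- Addition that drops zero summands. -/
def addZ : PolyExpr → PolyExpr → PolyExpr
  | zero, f => f
  | e, zero => e
  | e, f => add e f

/-- Multiplication that absorbs zero factors. -/
def mulZ : PolyExpr → PolyExpr → PolyExpr
  | zero, _ => zero
  | _, zero => zero
  | e, f => mul e f

section
variable {R : Type*} [CommRing R] (v : Fin 7 → R)

theorem eval_addZ (e f : PolyExpr) : (addZ e f).eval v = e.eval v + f.eval v := by
  cases e <;> cases f <;> simp [addZ, eval]

theorem eval_mulZ (e f : PolyExpr) : (mulZ e f).eval v = e.eval v * f.eval v := by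
  cases e <;> cases f <;> simp [mulZ, eval]

theorem map_eval {S : Type*} [CommRing S] (φ : R →+* S) (e : PolyExpr) :
    φ (e.eval v) = e.eval (fun i => φ (v i)) := by
  induction e <;> simp_all [eval]

theorem map_evalAbs {S : Type*} [CommRing S] (φ : R →+* S) (e : PolyExpr) :
    φ (e.evalAbs v) = e.evalAbs (fun i => φ (v i)) := by
  induction e <;> simp_all [evalAbs]

end

theorem evalAbs_one (e : PolyExpr) : e.evalAbs (fun _ => (1 : ℤ)) = e.coeffBound := by
  induction e <;> simp_all [evalAbs, coeffBound]

/-- The multivariate polynomial defined by an expression. -/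
noncomputable def toMv (e : PolyExpr) : MvPolynomial (Fin 7) ℤ := e.eval MvPolynomial.X

theorem degreeOf_toMv_le (i : Fin 7) (e : PolyExpr) : e.toMv.degreeOf i ≤ e.degBound i := by
  unfold toMv
  induction e with
  | zero => simp [eval]
  | one => simp [eval, degBound]
  | var j => simp [eval, degBound, MvPolynomial.degreeOf_X]
  | neg e ih => simpa [eval, degBound, MvPolynomial.degreeOf_neg] using ih
  | add e f he hf => exact (MvPolynomial.degreeOf_add_le _ _ _).trans (max_le_max he hf)
  | mul e f he hf => exact (MvPolynomial.degreeOf_mul_le _ _ _).trans (add_le_add he hf)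

theorem abs_coeff_toMv_le (m : Fin 7 →₀ ℕ) (e : PolyExpr) :
    |e.toMv.coeff m| ≤ (e.evalAbs (MvPolynomial.X : Fin 7 → MvPolynomial (Fin 7) ℤ)).coeff m := by
  unfold toMv
  induction e generalizing m with
  | zero => simp [eval, evalAbs]
  | one => simp only [eval, evalAbs, MvPolynomial.coeff_one]; split_ifs <;> simp
  | var j => simp only [eval, evalAbs, MvPolynomial.coeff_X]; split_ifs <;> simp
  | neg e ih => simpa [eval, evalAbs] using ih m
  | add e f he hf =>
    simp only [eval, evalAbs, MvPolynomial.coeff_add]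
    exact (abs_add_le _ _).trans (add_le_add (he m) (hf m))
  | mul e f he hf =>
    simp only [eval, evalAbs, MvPolynomial.coeff_mul]
    refine (Finset.abs_sum_le_sum_abs _ _).trans (Finset.sum_le_sum fun x _ => ?_)
    rw [abs_mul]
    exact mul_le_mul (he _) (hf _) (abs_nonneg _) ((abs_nonneg _).trans (he _))

theorem abs_coeff_toMv_le_coeffBound (m : Fin 7 →₀ ℕ) (e : PolyExpr) :
    |e.toMv.coeff m| ≤ e.coeffBound := by
  set M := e.evalAbs (MvPolynomial.X : Fin 7 → MvPolynomial (Fin 7) ℤ) with hM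
  have hnn : ∀ n, 0 ≤ M.coeff n := fun n => (abs_nonneg _).trans (abs_coeff_toMv_le n e)
  have h1 : MvPolynomial.eval (fun _ => (1 : ℤ)) M = e.coeffBound := by
    rw [hM, map_evalAbs, ← evalAbs_one]
    simp
  rw [← h1, MvPolynomial.eval_eq]
  refine (abs_coeff_toMv_le m e).trans ?_
  simp only [one_pow, Finset.prod_const_one, mul_one]
  by_cases hm : m ∈ M.support
  · exact Finset.single_le_sum (f := fun n => M.coeff n) (fun n _ => hnn n) hm
  · rw [← hM, MvPolynomial.notMem_support_iff.mp hm]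
    exact Finset.sum_nonneg fun n _ => hnn n

end PolyExpr

/-- Kronecker substitution: an integer polynomial with coefficients smaller than `b` vanishes as soon
as its value at powers of `b` separating its monomials does. -/
theorem MvPolynomial.eq_zero_of_eval_pow_eq_zero {σ : Type*} [Fintype σ] (P : MvPolynomial σ ℤ)
    (b : ℤ) (D : σ → ℕ) (hb : ∀ m, |P.coeff m| < b)
    (hD : Set.InjOn (fun m : σ →₀ ℕ => ∑ i, D i * m i) P.support)
    (h : MvPolynomial.eval (fun i => b ^ D i) P = 0) : P = 0 := by
  classical
  by_contra hP
  obtain ⟨m, hm, hmin⟩ := Finset.exists_min_image P.support (fun m => ∑ i, D i * m i)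
    (MvPolynomial.support_nonempty.mpr hP)
  have hb0 : 0 < b := (abs_nonneg _).trans_lt (hb m)
  rw [MvPolynomial.eval_eq', ← Finset.add_sum_erase _ _ hm] at h
  simp only [← pow_mul, Finset.prod_pow_eq_pow_sum] at h
  have hdvd : b ^ (∑ i, D i * m i + 1) ∣ P.coeff m * b ^ (∑ i, D i * m i) := by
    rw [eq_neg_of_add_eq_zero_left h]
    refine (Finset.dvd_sum fun n hn => Dvd.dvd.mul_left (pow_dvd_pow b ?_) _).neg_right
    obtain ⟨hne, hn⟩ := Finset.mem_erase.mp hn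
    exact lt_of_le_of_ne (hmin n hn) fun he => hne (hD hn hm he.symm)
  rw [pow_succ', mul_dvd_mul_iff_right (pow_pos hb0 _).ne'] at hdvd
  exact MvPolynomial.mem_support_iff.mp hm (Int.eq_zero_of_abs_lt_dvd hdvd (hb m))

namespace PolyExpr

/-- The variables standing for `ρ_a = p_a − q_a`. -/
def rho (a : Fin 4) : PolyExpr := var (Fin.castLE (by decide) a)

/-- The variables standing for `(p_a + q_a) − (p_3 + q_3)`. -/
def sig (a : Fin 4) : PolyExpr := ![var 4, var 5, var 6, zero] a

/-- Subtraction of expressions. -/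
def sub (e f : PolyExpr) : PolyExpr := addZ e (neg f)

/-- Twice `δ_{ijk}`. -/
def den (i j k : Fin 4) : PolyExpr :=
  addZ (addZ (mul (addZ (sub (sig j) (sig i)) (addZ (rho i) (rho j))) (mul (rho i) (rho j)))
    (mul (addZ (sub (sig k) (sig i)) (sub (rho i) (rho k))) (mul (rho i) (rho k))))
    (mul (sub (sub (sig k) (sig j)) (addZ (rho k) (rho j))) (mul (rho j) (rho k)))

/-- Twice the matrix `γ^{ijk}`, conjugated by the diagonal matrix of the differences of the `ρ_a ^ 2`. -/
def gam (i j k : Fin 4) : Fin 3 → Fin 3 → PolyExpr :=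
  let dbl (a : Fin 4) := addZ (rho a) (rho a)
  let sq (a : Fin 4) := mul (rho a) (rho a)
  let a := mul (rho i) (addZ (sub (sig k) (sig i)) (rho i))
  let b := mul (rho j) (sub (sub (sig k) (sig j)) (rho j))
  let c := mul (rho i) (addZ (sub (sig j) (sig i)) (rho i))
  let d := mul (rho k) (addZ (sub (sig j) (sig k)) (rho k))
  let e := mul (rho j) (sub (sub (sig i) (sig j)) (rho j))
  let f := mul (rho k) (addZ (sub (sig i) (sig k)) (rho k))
  ![![mul (dbl k) (add a b), mul (dbl k) (sub a (sq k)), neg (mul (dbl k) (add b (sq k)))],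
    ![mul (dbl j) (sub c (sq j)), mul (dbl j) (sub c d), mul (dbl j) (sub (sq j) d)],
    ![mul (dbl i) (add e (sq i)), mul (dbl i) (sub (sq i) f), neg (mul (dbl i) (add e f))]]

/-- The numerators of the conjugated matrix `S(i,j,k)` over the denominator `den i j k`. -/
def num (i j k : Fin 4) (a b : Fin 3) : PolyExpr :=
  if a = b then sub (gam i j k a b) (den i j k) else gam i j k a b

/-- The 3×3 block `B` placed in `c` times the 6×6 identity matrix, where `g` sends a row index to its
position in the block. -/
def emb (g : Fin 6 → Option (Fin 3)) (c : PolyExpr) (B : Fin 3 → Fin 3 → PolyExpr)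
    (r s : Fin 6) : PolyExpr :=
  match g r, g s with
  | some i, some j => B i j
  | none, none => if r = s then c else zero
  | _, _ => zero

/-- Multiplication of 6×6 matrices of expressions. -/
def matMul (A B : Fin 6 → Fin 6 → PolyExpr) (r s : Fin 6) : PolyExpr :=
  addZ (addZ (addZ (mulZ (A r 0) (B 0 s)) (mulZ (A r 1) (B 1 s)))
    (addZ (mulZ (A r 2) (B 2 s)) (mulZ (A r 3) (B 3 s))))
    (addZ (mulZ (A r 4) (B 4 s)) (mulZ (A r 5) (B 5 s)))

/-- The numerators of the 6×6 matrix with the conjugated `S(i,j,k)` as its block. -/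
def block (g : Fin 6 → Option (Fin 3)) (i j k : Fin 4) : Fin 6 → Fin 6 → PolyExpr :=
  emb g (den i j k) (num i j k)

/-- The position of a row index in the block `(1,2,3)`. -/
def pos123 : Fin 6 → Option (Fin 3) := ![some 0, some 1, some 2, none, none, none]

/-- The numerators of `ℛ` for the block `(1,2,3)`. -/
def block123 : Fin 6 → Fin 6 → PolyExpr := block pos123 0 1 2

/-- The position of a row index in the block `(1,4,5)`. -/
def pos145 : Fin 6 → Option (Fin 3) := ![some 0, none, none, some 1, some 2, none]

/-- The numerators of `ℛ` for the block `(1,4,5)`. -/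
def block145 : Fin 6 → Fin 6 → PolyExpr := block pos145 0 1 3

/-- The position of a row index in the block `(2,4,6)`. -/
def pos246 : Fin 6 → Option (Fin 3) := ![none, some 0, none, some 1, none, some 2]

/-- The numerators of `ℛ` for the block `(2,4,6)`. -/
def block246 : Fin 6 → Fin 6 → PolyExpr := block pos246 0 2 3

/-- The position of a row index in the block `(3,5,6)`. -/
def pos356 : Fin 6 → Option (Fin 3) := ![none, none, some 0, none, some 1, some 2]

/-- The numerators of `ℛ` for the block `(3,5,6)`. -/
def block356 : Fin 6 → Fin 6 → PolyExpr := block pos356 1 2 3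

/-- The left-hand side of the tetrahedron equation. -/
def tetraLhs : Fin 6 → Fin 6 → PolyExpr :=
  matMul (matMul block123 block145) (matMul block246 block356)

/-- The right-hand side of the tetrahedron equation. -/
def tetraRhs : Fin 6 → Fin 6 → PolyExpr :=
  matMul (matMul block356 block246) (matMul block145 block123)

/-- The entries of the difference of the two sides of the tetrahedron equation. -/
def tetraDiff (r s : Fin 6) : PolyExpr := sub (tetraLhs r s) (tetraRhs r s)

/-- Exponents separating the monomials of degree less than 8 in the first four variables and less
than 4 in the last three. -/
def weight : Fin 7 → ℕ := ![1, 8, 64, 512, 4096, 16384, 65536]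

/-- The value of an expression at the powers of `2 ^ 17` with exponents `weight`. -/
def evalInt : PolyExpr → ℤ
  | zero => 0
  | one => 1
  | var i => Int.ofNat ((2 ^ 17) ^ weight i)
  | neg e => -evalInt e
  | add e f => evalInt e + evalInt f
  | mul e f => evalInt e * evalInt f

theorem evalInt_eq_eval (e : PolyExpr) : e.evalInt = e.eval (fun i => (2 ^ 17) ^ weight i) := by
  induction e <;> simp_all [eval, evalInt]

theorem eval_eq_zero_of_evalInt {R : Type*} [CommRing R] (v : Fin 7 → R) (e : PolyExpr)
    (h0 : e.evalInt = 0) (hc : e.coeffBound < 2 ^ 17)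
    (hd : ∀ i, e.degBound i < ![8, 8, 8, 8, 4, 4, 4] i) : e.eval v = 0 := by
  have hP : e.toMv = 0 := by
    refine MvPolynomial.eq_zero_of_eval_pow_eq_zero _ (2 ^ 17) weight (fun m => ?_) ?_ ?_
    · exact (abs_coeff_toMv_le_coeffBound m e).trans_lt (by exact_mod_cast hc)
    · intro m hm n hn hmn
      have hdeg : ∀ m ∈ e.toMv.support, ∀ i, m i < ![8, 8, 8, 8, 4, 4, 4] i := fun m hm i =>
        ((MvPolynomial.monomial_le_degreeOf i hm).trans (degreeOf_toMv_le i e)).trans_lt (hd i)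
      have hm' := hdeg m hm
      have hn' := hdeg n hn
      simp [Fin.forall_fin_succ] at hm' hn'
      simp [weight, Fin.sum_univ_succ] at hmn
      ext i
      fin_cases i <;> simp <;> omega
    · rw [toMv, map_eval]
      simpa [evalInt_eq_eval] using h0
  have h := map_eval (MvPolynomial.X : Fin 7 → MvPolynomial (Fin 7) ℤ)
    (MvPolynomial.eval₂Hom (Int.castRingHom R) v) e
  rw [← toMv, hP] at h
  simpa using h.symm

set_option maxRecDepth 100000 in
theorem eval_tetraDiff {R : Type*} [CommRing R] (v : Fin 7 → R) (r s : Fin 6) :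
    (tetraDiff r s).eval v = 0 := by
  have h0 : ∀ r s, (tetraDiff r s).evalInt = 0 := by decide +kernel
  have hc : ∀ r s, (tetraDiff r s).coeffBound < 2 ^ 17 := by decide +kernel
  have hd : ∀ r s i, (tetraDiff r s).degBound i < ![8, 8, 8, 8, 4, 4, 4] i := by decide +kernel
  exact eval_eq_zero_of_evalInt v _ (h0 r s) (hc r s) (hd r s)

section
variable {R : Type*} [CommRing R] (v : Fin 7 → R)

theorem eval_sub (e f : PolyExpr) : (sub e f).eval v = e.eval v - f.eval v := by
  simp [sub, eval_addZ, eval, sub_eq_add_neg]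

/-- The matrix of values of a matrix of expressions. -/
def evalMat (A : Fin 6 → Fin 6 → PolyExpr) : Matrix (Fin 6) (Fin 6) R :=
  Matrix.of fun r s => (A r s).eval v

theorem evalMat_matMul (A B : Fin 6 → Fin 6 → PolyExpr) :
    evalMat v (matMul A B) = evalMat v A * evalMat v B := by
  ext r s
  simp [evalMat, matMul, eval_addZ, eval_mulZ, Matrix.mul_apply, Fin.sum_univ_six]
  ring

theorem tetrahedron_evalMat :
    evalMat v block123 * evalMat v block145
        * evalMat v block246 * evalMat v block356
      = evalMat v block356 * evalMat v block246
        * evalMat v block145 * evalMat v block123 := by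
  rw [Matrix.mul_assoc (_ * _), Matrix.mul_assoc (_ * _)]
  simp only [← evalMat_matMul]
  ext r s
  have h := eval_tetraDiff v r s
  rw [tetraDiff, eval_sub, tetraLhs, tetraRhs] at h
  exact sub_eq_zero.mp h

end

end PolyExpr

open PolyExpr

/-- The values of the variables: `p_a − q_a` and `(p_a + q_a) − (p_3 + q_3)`. -/
def solitonVars (p q : Fin 4 → ℝ) : Fin 7 → ℝ :=
  ![p 0 - q 0, p 1 - q 1, p 2 - q 2, p 3 - q 3, p 0 + q 0 - (p 3 + q 3),
    p 1 + q 1 - (p 3 + q 3), p 2 + q 2 - (p 3 + q 3)]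

theorem eval_rho (p q : Fin 4 → ℝ) (a : Fin 4) : (rho a).eval (solitonVars p q) = p a - q a := by
  fin_cases a <;> simp [rho, eval, solitonVars, Fin.castLE]

theorem eval_sig (p q : Fin 4 → ℝ) (a : Fin 4) :
    (sig a).eval (solitonVars p q) = p a + q a - (p 3 + q 3) := by
  fin_cases a <;> simp [sig, eval, solitonVars]

theorem eval_den (p q : Fin 4 → ℝ) (i j k : Fin 4) :
    (den i j k).eval (solitonVars p q) = 2 * deltaT p q i j k := by
  simp only [den, eval_addZ, eval_sub, eval, eval_rho, eval_sig, deltaT]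
  ring

/-- The difference of the squares of `p_a − q_a` and `p_b − q_b`. -/
def sqDiff (p q : Fin 4 → ℝ) (a b : Fin 4) : ℝ := (p a - q a) ^ 2 - (p b - q b) ^ 2

theorem Smat_apply (p q : Fin 4 → ℝ) (i j k : Fin 4) (hij : sqDiff p q i j ≠ 0)
    (hik : sqDiff p q i k ≠ 0) (hjk : sqDiff p q j k ≠ 0) (hδ : deltaT p q i j k ≠ 0)
    (a b : Fin 3) :
    Smat p q i j k a b = ![sqDiff p q i j, sqDiff p q i k, sqDiff p q j k] a *
      ((2 * deltaT p q i j k)⁻¹ * (num i j k a b).eval (solitonVars p q)) *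
      (![sqDiff p q i j, sqDiff p q i k, sqDiff p q j k] b)⁻¹ := by
  have h : ∀ a b, (p a - q a) ^ 2 - (p b - q b) ^ 2 = sqDiff p q a b := fun _ _ => rfl
  have hS : ∀ a b, Smat p q i j k a b = ![sqDiff p q i j, sqDiff p q i k, sqDiff p q j k] a *
      ((2 * deltaT p q i j k)⁻¹ * (gam i j k a b).eval (solitonVars p q)) *
      (![sqDiff p q i j, sqDiff p q i k, sqDiff p q j k] b)⁻¹
      - (1 : Matrix (Fin 3) (Fin 3) ℝ) a b := by
    intro a b
    rw [Smat]
    simp only [Matrix.sub_apply, Matrix.smul_apply, smul_eq_mul, h]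
    congr 1
    fin_cases a <;> fin_cases b <;>
      simp [gam, eval, eval_addZ, eval_sub, eval_rho, eval_sig] <;> field_simp <;> ring
  have hw : ![sqDiff p q i j, sqDiff p q i k, sqDiff p q j k] a ≠ 0 := by
    fin_cases a <;> simpa
  rw [hS, num]
  split_ifs with hab
  · subst hab
    rw [eval_sub, eval_den, Matrix.one_apply_eq]
    field_simp
  · rw [Matrix.one_apply_ne hab, sub_zero]

/-- The gauge transformation clearing the denominators `sqDiff`. -/
def diffGauge (p q : Fin 4 → ℝ) : Fin 6 → ℝ :=
  ![sqDiff p q 0 1, sqDiff p q 0 2, sqDiff p q 1 2, sqDiff p q 0 3, sqDiff p q 1 3, sqDiff p q 2 3]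

theorem embT_Smat (p q : Fin 4 → ℝ) (hw : ∀ r, diffGauge p q r ≠ 0) (f : Fin 3 → Fin 6)
    (g : Fin 6 → Option (Fin 3)) (hfg : ∀ r i, g r = some i ↔ f i = r) (i j k : Fin 4)
    (hf : ∀ a, diffGauge p q (f a) = ![sqDiff p q i j, sqDiff p q i k, sqDiff p q j k] a)
    (hδ : deltaT p q i j k ≠ 0) :
    embT f (Smat p q i j k) = Matrix.diagonal (diffGauge p q) *
      ((2 * deltaT p q i j k)⁻¹ • evalMat (solitonVars p q) (block g i j k)) *
      Matrix.diagonal (diffGauge p q)⁻¹ := by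
  have hinj : Function.Injective f := fun a b hab => by
    have ha := (hfg (f b) a).mpr hab
    rw [(hfg (f b) b).mpr rfl] at ha
    exact (Option.some.inj ha).symm
  have hS := Smat_apply p q i j k (by simpa [hf] using hw (f 0)) (by simpa [hf] using hw (f 1))
    (by simpa [hf] using hw (f 2)) hδ
  ext r s
  rw [Matrix.mul_diagonal, Matrix.diagonal_mul, Pi.inv_apply, Matrix.smul_apply, smul_eq_mul]
  simp only [embT, evalMat, Matrix.of_apply, block, emb]
  rcases hr : g r with _ | a
  · have hr' : ∀ a, f a ≠ r := fun a ha => by simp [(hfg r a).mpr ha] at hr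
    rcases hs : g s with _ | b
    · by_cases hrs : r = s
      · subst hrs
        have := hw r
        simp [hr', eval_den]
        field_simp
      · simp [hr', hrs, eval]
    · obtain rfl := (hfg s b).mp hs
      simp [hr', eval, (hr' b).symm]
  · obtain rfl := (hfg r a).mp hr
    rcases hs : g s with _ | b
    · have hs' : ∀ a, f a ≠ s := fun a ha => by simp [(hfg s a).mpr ha] at hs
      simp [hs', eval]
    · obtain rfl := (hfg s b).mp hs
      simp [hinj.eq_iff, ite_and, hf, hS a b]

/-- A solution of the tetrahedron (Zamolodchikov) equation from pure vector KP solitons. -/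
theorem stmt_16 (p q : Fin 4 → ℝ)
    (hρ : ∀ a b, a ≠ b → (p a - q a) ^ 2 ≠ (p b - q b) ^ 2)
    (hδ123 : deltaT p q 0 1 2 ≠ 0) (hδ124 : deltaT p q 0 1 3 ≠ 0)
    (hδ134 : deltaT p q 0 2 3 ≠ 0) (hδ234 : deltaT p q 1 2 3 ≠ 0) :
    embT ![0, 1, 2] (Smat p q 0 1 2) * embT ![0, 3, 4] (Smat p q 0 1 3)
        * embT ![1, 3, 5] (Smat p q 0 2 3) * embT ![2, 4, 5] (Smat p q 1 2 3)
      = embT ![2, 4, 5] (Smat p q 1 2 3) * embT ![1, 3, 5] (Smat p q 0 2 3)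
        * embT ![0, 3, 4] (Smat p q 0 1 3) * embT ![0, 1, 2] (Smat p q 0 1 2) := by
  have hne : ∀ a b, a ≠ b → sqDiff p q a b ≠ 0 := fun a b hab => sub_ne_zero.mpr (hρ a b hab)
  have hw : ∀ r, diffGauge p q r ≠ 0 := by
    intro r
    fin_cases r <;> exact hne _ _ (by decide)
  have hD : Matrix.diagonal (diffGauge p q)⁻¹ * Matrix.diagonal (diffGauge p q) = 1 := by
    rw [Matrix.diagonal_mul_diagonal, ← Matrix.diagonal_one]
    congr 1
    ext r
    exact inv_mul_cancel₀ (hw r)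
  have hconj : ∀ A B : Matrix (Fin 6) (Fin 6) ℝ,
      Matrix.diagonal (diffGauge p q) * A * Matrix.diagonal (diffGauge p q)⁻¹ *
        (Matrix.diagonal (diffGauge p q) * B * Matrix.diagonal (diffGauge p q)⁻¹) =
      Matrix.diagonal (diffGauge p q) * (A * B) * Matrix.diagonal (diffGauge p q)⁻¹ := fun A B => by
    simp only [Matrix.mul_assoc]
    rw [← Matrix.mul_assoc (Matrix.diagonal (diffGauge p q)⁻¹), hD, Matrix.one_mul]
  rw [embT_Smat p q hw ![0, 1, 2] pos123 (by decide) 0 1 2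
      (fun a => by fin_cases a <;> rfl) hδ123,
    embT_Smat p q hw ![0, 3, 4] pos145 (by decide) 0 1 3
      (fun a => by fin_cases a <;> rfl) hδ124,
    embT_Smat p q hw ![1, 3, 5] pos246 (by decide) 0 2 3
      (fun a => by fin_cases a <;> rfl) hδ134,
    embT_Smat p q hw ![2, 4, 5] pos356 (by decide) 1 2 3
      (fun a => by fin_cases a <;> rfl) hδ234]
  have h := tetrahedron_evalMat (solitonVars p q)
  simp only [block123, block145, block246, block356] at h
  simp only [hconj, Matrix.smul_mul, Matrix.mul_smul, smul_smul, h]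
  congr 1
  ring
end

section
/- (KdV reduction tetrahedron solution.) For real parameters p₁,…,p₄ with p_a ≠ p_b and p_a + p_b ≠ 0 for all a ≠ b, define the 3×3 matrix S_KdV(i,j,k) with rows ( −((p_i+p_k)(p_j−p_k))/((p_i−p_k)(p_j+p_k)), (2(p_i−p_j)p_k)/((p_i−p_k)(p_j+p_k)), (2(p_i−p_j)p_k)/((p_i−p_k)(p_j+p_k)) ), ( (2p_j(p_i+p_k))/((p_i+p_j)(p_j+p_k)), ((p_i−p_j)(p_j−p_k))/((p_i+p_j)(p_j+p_k)), (2p_j(p_i+p_k))/((p_i+p_j)(p_j+p_k)) ), ( (2p_i(p_j−p_k))/((p_i+p_j)(p_i−p_k)), (2p_i(p_j−p_k))/((p_i+p_j)(p_i−p_k)), −((p_i−p_j)(p_i+p_k))/((p_i+p_j)(p_i−p_k)) ). Let S_{αβγ}(i,j,k) be the 6×6 matrix equal to the identity except that S_KdV(i,j,k) is placed at rows and columns (α,β,γ). Then ℛ₁₂₃ ℛ₁₄₅ ℛ₂₄₆ ℛ₃₅₆ = ℛ₃₅₆ ℛ₂₄₆ ℛ₁₄₅ ℛ₁₂₃, where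 ℛ₁₂₃ = S_{123}(1,2,3), ℛ₁₄₅ = S_{145}(1,2,4), ℛ₂₄₆ = S_{246}(1,3,4), ℛ₃₅₆ = S_{356}(2,3,4). -/
open Matrix

/-- The KdV reduction `S_KdV(i,j,k)` of the vector KP tetrahedron solution. -/
noncomputable def SKdV (p : Fin 4 → ℝ) (i j k : Fin 4) : Matrix (Fin 3) (Fin 3) ℝ :=
  !![-((p i + p k) * (p j - p k)) / ((p i - p k) * (p j + p k)),
     2 * (p i - p j) * p k / ((p i - p k) * (p j + p k)),
     2 * (p i - p j) * p k / ((p i - p k) * (p j + p k));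
     2 * p j * (p i + p k) / ((p i + p j) * (p j + p k)),
     (p i - p j) * (p j - p k) / ((p i + p j) * (p j + p k)),
     2 * p j * (p i + p k) / ((p i + p j) * (p j + p k));
     2 * p i * (p j - p k) / ((p i + p j) * (p i - p k)),
     2 * p i * (p j - p k) / ((p i + p j) * (p i - p k)),
     -((p i - p j) * (p i + p k)) / ((p i + p j) * (p i - p k))]

lemma embT_zero_one_two (B : Matrix (Fin 3) (Fin 3) ℝ) :
    embT ![0, 1, 2] B =
      !![B 0 0, B 0 1, B 0 2, 0, 0, 0; B 1 0, B 1 1, B 1 2, 0, 0, 0;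
         B 2 0, B 2 1, B 2 2, 0, 0, 0; 0, 0, 0, 1, 0, 0; 0, 0, 0, 0, 1, 0; 0, 0, 0, 0, 0, 1] := by
  ext r s
  fin_cases r <;> fin_cases s <;> simp [embT, Fin.sum_univ_three, Fin.forall_fin_succ]

lemma embT_zero_three_four (B : Matrix (Fin 3) (Fin 3) ℝ) :
    embT ![0, 3, 4] B =
      !![B 0 0, 0, 0, B 0 1, B 0 2, 0; 0, 1, 0, 0, 0, 0; 0, 0, 1, 0, 0, 0;
         B 1 0, 0, 0, B 1 1, B 1 2, 0; B 2 0, 0, 0, B 2 1, B 2 2, 0; 0, 0, 0, 0, 0, 1] := by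
  ext r s
  fin_cases r <;> fin_cases s <;> simp [embT, Fin.sum_univ_three, Fin.forall_fin_succ]

lemma embT_one_three_five (B : Matrix (Fin 3) (Fin 3) ℝ) :
    embT ![1, 3, 5] B =
      !![1, 0, 0, 0, 0, 0; 0, B 0 0, 0, B 0 1, 0, B 0 2; 0, 0, 1, 0, 0, 0;
         0, B 1 0, 0, B 1 1, 0, B 1 2; 0, 0, 0, 0, 1, 0; 0, B 2 0, 0, B 2 1, 0, B 2 2] := by
  ext r s
  fin_cases r <;> fin_cases s <;> simp [embT, Fin.sum_univ_three, Fin.forall_fin_succ]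

lemma embT_two_four_five (B : Matrix (Fin 3) (Fin 3) ℝ) :
    embT ![2, 4, 5] B =
      !![1, 0, 0, 0, 0, 0; 0, 1, 0, 0, 0, 0; 0, 0, B 0 0, 0, B 0 1, B 0 2;
         0, 0, 0, 1, 0, 0; 0, 0, B 1 0, 0, B 1 1, B 1 2; 0, 0, B 2 0, 0, B 2 1, B 2 2] := by
  ext r s
  fin_cases r <;> fin_cases s <;> simp [embT, Fin.sum_univ_three, Fin.forall_fin_succ]

set_option maxHeartbeats 4000000 in
/-- The KdV reduction solution of the tetrahedron (Zamolodchikov) equation. -/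
theorem stmt_17 (p : Fin 4 → ℝ)
    (hne : ∀ a b, a ≠ b → p a ≠ p b)
    (hsum : ∀ a b, a ≠ b → p a + p b ≠ 0) :
    embT ![0, 1, 2] (SKdV p 0 1 2) * embT ![0, 3, 4] (SKdV p 0 1 3)
        * embT ![1, 3, 5] (SKdV p 0 2 3) * embT ![2, 4, 5] (SKdV p 1 2 3)
      = embT ![2, 4, 5] (SKdV p 1 2 3) * embT ![1, 3, 5] (SKdV p 0 2 3)
        * embT ![0, 3, 4] (SKdV p 0 1 3) * embT ![0, 1, 2] (SKdV p 0 1 2) := by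
  have d01 := sub_ne_zero.2 (hne 0 1 (by decide))
  have d02 := sub_ne_zero.2 (hne 0 2 (by decide))
  have d03 := sub_ne_zero.2 (hne 0 3 (by decide))
  have d12 := sub_ne_zero.2 (hne 1 2 (by decide))
  have d13 := sub_ne_zero.2 (hne 1 3 (by decide))
  have d23 := sub_ne_zero.2 (hne 2 3 (by decide))
  have s01 := hsum 0 1 (by decide)
  have s02 := hsum 0 2 (by decide)
  have s03 := hsum 0 3 (by decide)
  have s12 := hsum 1 2 (by decide)
  have s13 := hsum 1 3 (by decide)
  have s23 := hsum 2 3 (by decide)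
  rw [embT_zero_one_two, embT_zero_three_four, embT_one_three_five, embT_two_four_five]
  generalize hA : p 0 = a at *
  generalize hB : p 1 = b at *
  generalize hC : p 2 = c at *
  generalize hD : p 3 = d at *
  ext r s
  fin_cases r <;> fin_cases s <;>
    simp [Matrix.mul_apply, Fin.sum_univ_succ, SKdV, hA, hB, hC, hD] <;> field_simp <;> ring
end
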